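/- Let f : ℝ^m → ℝ be continuously differentiable, let d ∈ ℝ^m be fixed, let β ∈ (0,1), θ ∈ (0,1), and δ > 0. There is no sequence (x_k) in ℝ^m converging to some point x̄ together with positive stepsizes λ_k → 0 such that for every k both ⟨f'(x_k), d⟩ ≤ −δ and f(x_k + (λ_k/θ) d) − f(x_k) > β (λ_k/θ) ⟨f'(x_k), d⟩ hold. -/

import Mathlib

open RealInnerProductSpace Filter Topology

/-- Mean value theorem along the segment from `x` to `x + t • d`. -/
theorem exists_inner_gradient_eq_sub {E : Type*} [NormedAddCommGroup E] [InnerProductSpace ℝ E]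
    [CompleteSpace E] {f : E → ℝ} {f' : E → E} (hf : ∀ x, HasGradientAt f (f' x) x)
    (x d : E) {t : ℝ} (ht : 0 < t) :
    ∃ c ∈ Set.Ioo 0 t, f (x + t • d) - f x = t * ⟪f' (x + c • d), d⟫ := by
  have hderiv (s : ℝ) : HasDerivAt (fun s : ℝ => f (x + s • d)) ⟪f' (x + s • d), d⟫ s := by
    have hline : HasDerivAt (fun s : ℝ => x + s • d) d s := by
      simpa using ((hasDerivAt_id s).smul_const d).const_add x
    simpa [Function.comp_def] using
      (hf (x + s • d)).hasFDerivAt.comp_hasDerivAt s hline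
  obtain ⟨c, hc, h⟩ := exists_hasDerivAt_eq_slope (fun s : ℝ => f (x + s • d)) _ ht
    (fun s _ => (hderiv s).continuousAt.continuousWithinAt) (fun s _ => hderiv s)
  refine ⟨c, hc, ?_⟩
  rw [h, sub_zero, zero_smul, add_zero, mul_div_cancel₀ _ (ne_of_gt ht)]

/-- From the proof of Proposition 3.1: for a continuously differentiable f, fixed direction d,
β, θ ∈ (0,1) and δ > 0, there is no sequence x_k → x̄ with positive stepsizes λ_k → 0 such
that for every k both ⟨f'(x_k), d⟩ ≤ −δ and the Armijo condition fails at stepsize λ_k/θ,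
i.e. f(x_k + (λ_k/θ) d) − f(x_k) > β (λ_k/θ) ⟨f'(x_k), d⟩. -/
theorem stmt_10 {m : ℕ} (f : EuclideanSpace ℝ (Fin m) → ℝ)
    (f' : EuclideanSpace ℝ (Fin m) → EuclideanSpace ℝ (Fin m))
    (hf : ∀ x, HasGradientAt f (f' x) x) (hf' : Continuous f')
    (d : EuclideanSpace ℝ (Fin m))
    (β θ δ : ℝ) (hβ : β ∈ Set.Ioo (0:ℝ) 1) (hθ : θ ∈ Set.Ioo (0:ℝ) 1) (hδ : 0 < δ) :
    ¬ ∃ (x : ℕ → EuclideanSpace ℝ (Fin m)) (xbar : EuclideanSpace ℝ (Fin m)) (lam : ℕ → ℝ),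
        Tendsto x atTop (𝓝 xbar) ∧ (∀ k, 0 < lam k) ∧ Tendsto lam atTop (𝓝 0) ∧
        (∀ k, ⟪f' (x k), d⟫ ≤ -δ ∧
          f (x k + (lam k / θ) • d) - f (x k) > β * (lam k / θ) * ⟪f' (x k), d⟫) := by
  rintro ⟨x, xbar, lam, hx, hpos, hlam, h⟩
  have ht (k : ℕ) : 0 < lam k / θ := div_pos (hpos k) hθ.1
  choose c hc hmean using fun k => exists_inner_gradient_eq_sub hf (x k) d (ht k)
  have hc_tendsto : Tendsto c atTop (𝓝 0) :=
    squeeze_zero (fun k => (hc k).1.le) (fun k => (hc k).2.le) (by simpa using hlam.div_const θ)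
  have hy : Tendsto (fun k => x k + c k • d) atTop (𝓝 xbar) := by
    simpa using hx.add (hc_tendsto.smul_const d)
  have hcont : Continuous fun z => ⟪f' z, d⟫ := by fun_prop
  have hx_inner := (hcont.tendsto xbar).comp hx
  have hy_inner := (hcont.tendsto xbar).comp hy
  have hneg : ⟪f' xbar, d⟫ ≤ -δ := le_of_tendsto' hx_inner fun k => (h k).1
  have hle : β * ⟪f' xbar, d⟫ ≤ ⟪f' xbar, d⟫ := by
    refine le_of_tendsto_of_tendsto' (hx_inner.const_mul β) hy_inner fun k => ?_
    have hk := (h k).2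
    rw [hmean k] at hk
    refine le_of_mul_le_mul_left ?_ (ht k)
    simp only [Function.comp_apply]
    linarith
  nlinarith [hβ.2]
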